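/- For the clipped Advantage Learning iterates Q_{k+1} = T_clip Q_k starting from any Q_0 : S × A → ℝ, with V_k(s) = max_a Q_k(s,a), define the clipped-AL action gap G_clipAL(s,a) = liminf_{k→∞} [V_k(s) − Q_k(s,a)]. Then for every state s and action a: V*(s) − Q*(s,a) ≤ G_clipAL(s,a) ≤ (1/(1−α)) · [V*(s) − Q*(s,a)], where the right-hand side is the action gap attained by the AL operator. -/

import Mathlib

open Filter Topology Finset

/-- Value function induced by a Q-function: `V_Q(s) = max_a Q(s,a)`. -/
noncomputable def Vof {S A : Type*} [Fintype A] [Nonempty A]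
    (Q : S → A → ℝ) (s : S) : ℝ := ⨆ a, Q s a

/-- Bellman optimality operator `(T Q)(s,a) = r(s,a) + γ Σ_{s'} P(s'|s,a) V_Q(s')`. -/
noncomputable def bellmanOp {S A : Type*} [Fintype S] [Fintype A] [Nonempty A]
    (P : S → A → S → ℝ) (r : S → A → ℝ) (γ : ℝ)
    (Q : S → A → ℝ) : S → A → ℝ :=
  fun s a => r s a + γ * ∑ s', P s a s' * Vof Q s'

/-- Advantage Learning operator `(T_AL Q)(s,a) = (T Q)(s,a) - α (V_Q(s) - Q(s,a))`. -/
noncomputable def alOp {S A : Type*} [Fintype S] [Fintype A] [Nonempty A]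
    (P : S → A → S → ℝ) (r : S → A → ℝ) (γ α : ℝ)
    (Q : S → A → ℝ) : S → A → ℝ :=
  fun s a => bellmanOp P r γ Q s a - α * (Vof Q s - Q s a)

/-- Clipped Advantage Learning operator. -/
noncomputable def clipOp {S A : Type*} [Fintype S] [Fintype A] [Nonempty A]
    (P : S → A → S → ℝ) (r : S → A → ℝ) (γ α c Ql : ℝ)
    (Q : S → A → ℝ) : S → A → ℝ :=
  fun s a => if Q s a - Ql ≥ c * (Vof Q s - Ql)
    then alOp P r γ α Q s a else bellmanOp P r γ Q s a

/-- Sup norm over a finite nonempty domain. -/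
noncomputable def supNorm {S : Type*} [Fintype S] [Nonempty S] (f : S → ℝ) : ℝ :=
  ⨆ s, |f s|

lemma Vof_ge {S A : Type*} [Fintype A] [Nonempty A] (Q : S → A → ℝ) (s : S) (a : A) :
    Q s a ≤ Vof Q s := le_ciSup (f := fun a => Q s a) (Set.finite_range _).bddAbove a

lemma Vof_att {S A : Type*} [Fintype A] [Nonempty A] (Q : S → A → ℝ) (s : S) :
    ∃ a, Q s a = Vof Q s := exists_eq_ciSup_of_finite (f := fun a => Q s a)

lemma rec_bound (α : ℝ) (hα0 : 0 ≤ α) (hα1 : α < 1) (g h : ℕ → ℝ) (l : ℝ)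
    (hg : ∀ k, g (k+1) ≤ h k + α * g k) (hh : Tendsto h atTop (𝓝 l)) (ε : ℝ) (hε : 0 < ε) :
    ∀ᶠ k in atTop, g k ≤ 1 / (1 - α) * l + ε := by
  have h1 : 0 < 1 - α := by linarith
  have hδ : 0 < ε / 2 * (1 - α) := by positivity
  obtain ⟨K, hK⟩ := eventually_atTop.1 (hh.eventually (ge_mem_nhds (show l < l + ε / 2 * (1 - α) by linarith)))
  set M := 1 / (1 - α) * l + ε / 2 with hM
  have hM' : (1 - α) * M = l + ε / 2 * (1 - α) := by rw [hM]; field_simp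
  have key : ∀ n, g (n + K) - M ≤ α ^ n * (g K - M) := by
    intro n
    induction n with
    | zero => simp
    | succ n ih =>
      have e : n + 1 + K = n + K + 1 := by ring
      rw [e, pow_succ]
      have := hg (n + K)
      have := hK (n + K) (by omega)
      have := mul_le_mul_of_nonneg_left ih hα0
      nlinarith
  have ht : Tendsto (fun n => α ^ n * (g K - M)) atTop (𝓝 (0 * (g K - M))) :=
    (tendsto_pow_atTop_nhds_zero_of_lt_one hα0 hα1).mul_const _
  rw [zero_mul] at ht
  obtain ⟨N, hN⟩ := eventually_atTop.1 (ht.eventually (ge_mem_nhds (show (0:ℝ) < ε / 2 by linarith)))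
  refine eventually_atTop.2 ⟨N + K, fun k hk => ?_⟩
  have a1 := key (k - K)
  have a2 := hN (k - K) (by omega)
  rw [Nat.sub_add_cancel (by omega)] at a1
  linarith

lemma avg_le {S : Type*} [Fintype S] (p f : S → ℝ) (hp : ∀ s, 0 ≤ p s) (h1 : ∑ s, p s = 1)
    (C : ℝ) (hf : ∀ s, f s ≤ C) : ∑ s, p s * f s ≤ C := by
  calc ∑ s, p s * f s ≤ ∑ s, p s * C := Finset.sum_le_sum fun s _ =>
        mul_le_mul_of_nonneg_left (hf s) (hp s)
    _ = C := by rw [← Finset.sum_mul, h1, one_mul]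

lemma bell_diff {S A : Type*} [Fintype S] [Fintype A] [Nonempty A]
    (P : S → A → S → ℝ) (hP0 : ∀ s a s', 0 ≤ P s a s')
    (hP1 : ∀ s a, ∑ s', P s a s' = 1)
    (r : S → A → ℝ) (γ : ℝ) (hγ0 : 0 ≤ γ) (U W : S → ℝ) (C : ℝ) (h : ∀ s, U s - W s ≤ C)
    (s : S) (a : A) :
    (r s a + γ * ∑ s', P s a s' * U s') - (r s a + γ * ∑ s', P s a s' * W s') ≤ γ * C := by
  have := avg_le (P s a) (fun s => U s - W s) (hP0 s a) (hP1 s a) C h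
  simp only [mul_sub, Finset.sum_sub_distrib] at this
  have := mul_le_mul_of_nonneg_left this hγ0
  linarith

theorem stmt_12
    {S A : Type*} [Fintype S] [Nonempty S] [Fintype A] [Nonempty A]
    (P : S → A → S → ℝ) (hP0 : ∀ s a s', 0 ≤ P s a s')
    (hP1 : ∀ s a, ∑ s', P s a s' = 1)
    (r : S → A → ℝ) (γ : ℝ) (hγ0 : 0 ≤ γ) (hγ1 : γ < 1)
    (Qstar : S → A → ℝ) (hQstar : bellmanOp P r γ Qstar = Qstar)
    (α : ℝ) (hα0 : 0 ≤ α) (hα1 : α < 1)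
    (c : ℝ) (hc0 : 0 < c) (hc1 : c < 1) (Ql : ℝ)
    (Qseq : ℕ → S → A → ℝ)
    (hQseq : ∀ k, Qseq (k + 1) = clipOp P r γ α c Ql (Qseq k))
 :
    ∀ (s : S) (a : A),
      Vof Qstar s - Qstar s a ≤
        Filter.liminf (fun k => Vof (Qseq k) s - Qseq k s a) atTop ∧
      Filter.liminf (fun k => Vof (Qseq k) s - Qseq k s a) atTop ≤
        1 / (1 - α) * (Vof Qstar s - Qstar s a) := by
  have hstar : ∀ s a, Qstar s a = r s a + γ * ∑ s', P s a s' * Vof Qstar s' := fun s a =>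
    (congrFun (congrFun hQstar s) a).symm
  have hub : ∀ k s a, Qseq (k+1) s a ≤ r s a + γ * ∑ s', P s a s' * Vof (Qseq k) s' := by
    intro k s a
    have h0 := mul_nonneg hα0 (sub_nonneg.2 (Vof_ge (Qseq k) s a))
    rw [hQseq]; unfold clipOp alOp bellmanOp
    split_ifs <;> linarith
  have hlb : ∀ k s a, (r s a + γ * ∑ s', P s a s' * Vof (Qseq k) s')
      - α * (Vof (Qseq k) s - Qseq k s a) ≤ Qseq (k+1) s a := by
    intro k s a
    have h0 := mul_nonneg hα0 (sub_nonneg.2 (Vof_ge (Qseq k) s a))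
    rw [hQseq]; unfold clipOp alOp bellmanOp
    split_ifs <;> linarith
  set V : ℕ → S → ℝ := fun k => Vof (Qseq k) with hV
  -- upper bound
  obtain ⟨C, hC⟩ := (Set.finite_range (fun s => V 0 s - Vof Qstar s)).bddAbove
  obtain ⟨D, hD⟩ := (Set.finite_range (fun s => V 0 s - V 1 s)).bddAbove
  have hup : ∀ k s, V k s - Vof Qstar s ≤ γ ^ k * C := by
    intro k
    induction k with
    | zero => intro s; simpa using hC ⟨s, rfl⟩
    | succ k ih =>
      intro s
      obtain ⟨a, ha⟩ := Vof_att (Qseq (k+1)) s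
      have h1 := hub k s a
      have h2 := bell_diff P hP0 hP1 r γ hγ0 (V k) (Vof Qstar) _ ih s a
      have h3 := Vof_ge Qstar s a
      rw [hstar s a] at h3
      have : V (k+1) s = Qseq (k+1) s a := ha.symm
      have e : γ ^ (k+1) * C = γ * (γ ^ k * C) := by ring
      rw [this, e]; simp only [hV] at h2 ⊢; linarith
  have hinc : ∀ k s, V k s - V (k+1) s ≤ γ ^ k * D := by
    intro k
    induction k with
    | zero => intro s; simpa using hD ⟨s, rfl⟩
    | succ k ih =>
      intro s
      obtain ⟨a, ha⟩ := Vof_att (Qseq (k+1)) s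
      have h1 := hub k s a
      have h2 := bell_diff P hP0 hP1 r γ hγ0 (V k) (V (k+1)) _ ih s a
      have h3 := Vof_ge (Qseq (k+1+1)) s a
      have h4 := hlb (k+1) s a
      rw [ha, sub_self, mul_zero] at h4
      have e : γ ^ (k+1) * D = γ * (γ ^ k * D) := by ring
      rw [e]; simp only [hV] at h2 ⊢; linarith
  have hγt := tendsto_pow_atTop_nhds_zero_of_lt_one hγ0 hγ1
  have h1γ : 0 < 1 - γ := by linarith
  have hconv : ∀ s, ∃ l, Tendsto (fun k => V k s) atTop (𝓝 l) := by
    intro s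
    have hmono : Monotone (fun k => V k s - γ ^ k * (D / (1 - γ))) := by
      refine monotone_nat_of_le_succ fun k => ?_
      have := hinc k s
      have e : γ ^ k * (D / (1 - γ)) - γ ^ (k+1) * (D / (1 - γ)) = γ ^ k * D := by
        field_simp
        ring
      linarith
    have hbdd : BddAbove (Set.range (fun k => V k s - γ ^ k * (D / (1 - γ)))) := by
      refine ⟨Vof Qstar s + |C| + |D / (1 - γ)|, ?_⟩
      rintro _ ⟨k, rfl⟩
      have a0 : 0 ≤ γ ^ k := pow_nonneg hγ0 k
      have a1 : γ ^ k ≤ 1 := pow_le_one₀ hγ0 hγ1.le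
      have b1 : γ ^ k * C ≤ |C| := by
        nlinarith [le_abs_self C, abs_nonneg C]
      have b2 : -(γ ^ k * (D / (1 - γ))) ≤ |D / (1 - γ)| := by
        nlinarith [neg_abs_le (D / (1 - γ)), abs_nonneg (D / (1 - γ))]
      have := hup k s
      show V k s - γ ^ k * (D / (1 - γ)) ≤ _
      linarith
    have h := (tendsto_atTop_ciSup hmono hbdd).add (hγt.mul_const (D / (1 - γ)))
    exact ⟨_, by simpa using h⟩
  choose L hL using hconv
  have hB : ∀ s a, Tendsto (fun k => r s a + γ * ∑ s', P s a s' * V k s') atTop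
      (𝓝 (r s a + γ * ∑ s', P s a s' * L s')) := by
    intro s a
    exact tendsto_const_nhds.add ((tendsto_finsetSum _ fun s' _ => (hL s').const_mul _).const_mul _)
  have hh : ∀ s a, Tendsto (fun k => V (k+1) s - (r s a + γ * ∑ s', P s a s' * V k s')) atTop
      (𝓝 (L s - (r s a + γ * ∑ s', P s a s' * L s'))) := fun s a =>
    ((tendsto_add_atTop_iff_nat 1).2 (hL s)).sub (hB s a)
  have hrec : ∀ s a (ε : ℝ), 0 < ε → ∀ᶠ k in atTop, V k s - Qseq k s a ≤
      1 / (1 - α) * (L s - (r s a + γ * ∑ s', P s a s' * L s')) + ε := by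
    intro s a ε hε
    refine rec_bound α hα0 hα1 (fun k => V k s - Qseq k s a) _ _ ?_ (hh s a) ε hε
    intro k
    have := hlb k s a
    simp only [hV]; linarith
  have h1α : 0 < 1 - α := by linarith
  have hLB : ∀ s a, r s a + γ * ∑ s', P s a s' * L s' ≤ L s := by
    intro s a
    have : 0 ≤ 1 / (1 - α) * (L s - (r s a + γ * ∑ s', P s a s' * L s')) := by
      refine le_of_forall_pos_le_add fun ε hε => ?_
      obtain ⟨k, hk⟩ := (hrec s a ε hε).exists
      have := Vof_ge (Qseq k) s a
      simp only [hV] at hk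
      linarith
    have := nonneg_of_mul_nonneg_right this (by positivity)
    linarith
  have hLle : ∀ s, L s ≤ Vof Qstar s := by
    intro s
    have ht : Tendsto (fun k => Vof Qstar s + γ ^ k * C) atTop (𝓝 (Vof Qstar s + 0 * C)) :=
      tendsto_const_nhds.add (hγt.mul_const C)
    have := le_of_tendsto_of_tendsto' (hL s) ht (fun k => by have := hup k s; linarith)
    simpa using this
  have hLge : ∀ s, Vof Qstar s ≤ L s := by
    obtain ⟨s0, hs0⟩ := Finite.exists_max (fun s => Vof Qstar s - L s)
    obtain ⟨a, ha⟩ := Vof_att Qstar s0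
    have h2 := bell_diff P hP0 hP1 r γ hγ0 (Vof Qstar) L _ hs0 s0 a
    rw [← hstar, ha] at h2
    have h3 := hLB s0 a
    have h4 : Vof Qstar s0 - L s0 ≤ 0 := by
      by_contra! hcon
      nlinarith
    intro s
    have := hs0 s
    linarith
  have hLeq : L = Vof Qstar := funext fun s => le_antisymm (hLle s) (hLge s)
  subst hLeq
  intro s a
  have hrec' := hrec s a
  have hh' := hh s a
  rw [← hstar] at hh' hrec'
  have hbelow : IsBoundedUnder (· ≥ ·) atTop (fun k => V k s - Qseq k s a) :=
    isBoundedUnder_of ⟨0, fun k => sub_nonneg.2 (Vof_ge (Qseq k) s a)⟩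
  have habove : IsBoundedUnder (· ≤ ·) atTop (fun k => V k s - Qseq k s a) :=
    ⟨_, eventually_map.2 (hrec' 1 one_pos)⟩
  constructor
  · refine le_of_forall_pos_sub_le fun ε hε => ?_
    refine le_liminf_of_le habove.isCoboundedUnder_ge ?_
    have h5 := hh'.eventually (le_mem_nhds (sub_lt_self _ hε))
    obtain ⟨N, hN⟩ := eventually_atTop.1 h5
    refine eventually_atTop.2 ⟨N + 1, fun k hk => ?_⟩
    obtain ⟨j, rfl⟩ : ∃ j, k = j + 1 := ⟨k - 1, by omega⟩
    have h6 := hN j (by omega)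
    have h7 := hub j s a
    simp only [hV] at h6 ⊢
    linarith
  · refine le_of_forall_pos_le_add fun ε hε => ?_
    exact liminf_le_of_frequently_le (hrec' ε hε).frequently hbelow
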